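/- Let κ, μ, m_d, r̂ > 0 and r > 0. Set σ = r̂/√(2μ(1+κ)) and d = σ√(2μκ). Then the mixture of the κ-μ density conditioned on a dominant-component shadowing value against the unit-power Nakagami-m density satisfies ∫₀^∞ (r^μ/(σ²(xd)^{μ−1})) e^{−(r²+x²d²)/(2σ²)} I_{μ−1}(xdr/σ²) · (2 m_d^{m_d} x^{2m_d−1} e^{−m_d x²}/Γ(m_d)) dx = (2 m_d^{m_d}(1+κ)^μ μ^μ / (Γ(μ)(m_d+κμ)^{m_d})) (r^{2μ−1}/r̂^{2μ}) e^{−r²(1+κ)μ/r̂²} · ₁F₁(m_d; μ; μ²κ(1+κ)r²/(r̂²(m_d+κμ))). -/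

import Mathlib

open MeasureTheory Set

/-- Pochhammer (rising factorial) symbol `(a)_n = Γ(a+n)/Γ(a)`. -/
noncomputable def poch (a : ℝ) (n : ℕ) : ℝ := Real.Gamma (a + n) / Real.Gamma a

/-- Beta function `B(x,y) = Γ(x)Γ(y)/Γ(x+y)`. -/
noncomputable def betaFn (x y : ℝ) : ℝ := Real.Gamma x * Real.Gamma y / Real.Gamma (x + y)

/-- Modified Bessel function of the first kind of real order ν. -/
noncomputable def besselI (ν x : ℝ) : ℝ :=
  ∑' k : ℕ, (x / 2) ^ (ν + 2 * (k : ℝ)) / ((k.factorial : ℝ) * Real.Gamma (ν + (k : ℝ) + 1))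

/-- Modified Bessel function of the second kind of real order ν. -/
noncomputable def besselK (ν x : ℝ) : ℝ :=
  ∫ t in Ioi (0 : ℝ), Real.exp (-x * Real.cosh t) * Real.cosh (ν * t)

/-- Confluent hypergeometric function ₁F₁(a;b;z). -/
noncomputable def hyp1F1 (a b z : ℝ) : ℝ :=
  ∑' n : ℕ, poch a n * z ^ n / (poch b n * (n.factorial : ℝ))

/-- Gauss hypergeometric function ₂F₁(a,b;c;z). -/
noncomputable def hyp2F1 (a b c z : ℝ) : ℝ :=
  ∑' n : ℕ, poch a n * poch b n * z ^ n / (poch c n * (n.factorial : ℝ))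

/-- Tricomi confluent hypergeometric function U(a,b,z). -/
noncomputable def tricomiU (a b z : ℝ) : ℝ :=
  (1 / Real.Gamma a) *
    ∫ t in Ioi (0 : ℝ), Real.exp (-z * t) * t ^ (a - 1) * (1 + t) ^ (b - a - 1)

/-- Regularized generalized hypergeometric function ₃F̃₁(a₁,a₂,a₃;b;z). -/
noncomputable def hyp3F1reg (a₁ a₂ a₃ b z : ℝ) : ℝ :=
  ∑' n : ℕ, poch a₁ n * poch a₂ n * poch a₃ n * z ^ n /
    (Real.Gamma (b + n) * (n.factorial : ℝ))

/-- Regularized generalized hypergeometric function ₂F̃₂(a,b;c,d;z). -/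
noncomputable def hyp2F2reg (a b c d z : ℝ) : ℝ :=
  ∑' n : ℕ, poch a n * poch b n * z ^ n /
    (Real.Gamma (c + n) * Real.Gamma (d + n) * (n.factorial : ℝ))

lemma poch_succ {a : ℝ} (ha : 0 < a) (n : ℕ) : poch a (n + 1) = poch a n * (a + n) := by
  have h : a + ((n + 1 : ℕ) : ℝ) = (a + n) + 1 := by push_cast; ring
  rw [poch, poch, h, Real.Gamma_add_one (by positivity)]
  ring

lemma summable_hyp1F1 {a b : ℝ} (ha : 0 < a) (hb : 0 < b) (z : ℝ) :
    Summable fun n : ℕ => poch a n * z ^ n / (poch b n * (n.factorial : ℝ)) := by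
  have hlim : Filter.Tendsto (fun n : ℕ => (a + n) / (b + n) * (z / (n + 1)))
      Filter.atTop (nhds 0) := by
    have h₁ : Filter.Tendsto (fun n : ℕ => (a + n) / (b + n)) Filter.atTop (nhds 1) := by
      simpa using tendsto_add_mul_div_add_mul_atTop_nhds a b (1 : ℝ) one_ne_zero
    simpa using h₁.mul (tendsto_const_div_atTop_nhds_zero_nat z |>.comp
      (Filter.tendsto_add_atTop_nat 1))
  refine summable_of_ratio_norm_eventually_le (r := 1 / 2) (by norm_num) ?_
  filter_upwards [hlim.norm.eventually (ge_mem_nhds (by simp : ‖(0 : ℝ)‖ < 1 / 2))] with n hn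
  have hstep : poch a (n + 1) * z ^ (n + 1) / (poch b (n + 1) * ((n + 1).factorial : ℝ)) =
      (a + n) / (b + n) * (z / (n + 1)) *
        (poch a n * z ^ n / (poch b n * (n.factorial : ℝ))) := by
    rw [poch_succ ha, poch_succ hb, Nat.factorial_succ, pow_succ]
    push_cast
    simp only [div_eq_mul_inv, mul_inv]
    ring
  rw [hstep, norm_mul]
  gcongr

lemma besselI_two_mul {ν y : ℝ} (hy : 0 < y) :
    besselI ν (2 * y) = y ^ ν * ∑' k : ℕ,
      y ^ (2 * k) / ((k.factorial : ℝ) * Real.Gamma (ν + (k : ℝ) + 1)) := by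
  rw [besselI, ← tsum_mul_left]
  refine tsum_congr fun k => ?_
  rw [mul_div_cancel_left₀ y two_ne_zero, Real.rpow_add hy, mul_div_assoc]
  norm_cast

/-- Moments of `x ^ (2 a - 1) * exp (-p x²)` on the positive half-line. -/
lemma integral_rpow_mul_pow_mul_exp_neg_mul_sq {a p : ℝ} (ha : 0 < a) (hp : 0 < p) (n : ℕ) :
    ∫ x in Ioi (0 : ℝ), x ^ (2 * a - 1) * x ^ (2 * n) * Real.exp (-p * x ^ 2) =
      Real.Gamma (a + n) / (2 * p ^ a * p ^ n) := by
  have h := integral_rpow_mul_exp_neg_mul_rpow (p := 2) (q := 2 * (a + n) - 1) two_pos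
    (by have : (0 : ℝ) < a + n := by positivity
        linarith) hp
  have hq : (2 * (a + n) - 1 + 1) / 2 = a + n := by ring
  have hq' : -(2 * (a + n) - 1 + 1) / 2 = -(a + n) := by ring
  rw [hq, hq', Real.rpow_neg hp.le, Real.rpow_add hp, Real.rpow_natCast] at h
  calc
    _ = ∫ x in Ioi (0 : ℝ), x ^ (2 * (a + n) - 1) * Real.exp (-p * x ^ (2 : ℝ)) := by
      refine setIntegral_congr_fun measurableSet_Ioi fun x (hx : 0 < x) => ?_
      have he : 2 * (a + n) - 1 = (2 * a - 1) + ((2 * n : ℕ) : ℝ) := by push_cast; ring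
      simp only [he, Real.rpow_add hx, Real.rpow_natCast, Real.rpow_two]
    _ = _ := by
      rw [h]
      field_simp

lemma integrableOn_rpow_mul_pow_mul_exp_neg_mul_sq {a p : ℝ} (ha : 0 < a) (hp : 0 < p) (n : ℕ) :
    IntegrableOn (fun x : ℝ => x ^ (2 * a - 1) * x ^ (2 * n) * Real.exp (-p * x ^ 2)) (Ioi 0) := by
  refine Integrable.of_integral_ne_zero ?_
  rw [integral_rpow_mul_pow_mul_exp_neg_mul_sq ha hp]
  have := Real.Gamma_pos_of_pos (show 0 < a + n by positivity)
  positivity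

lemma integral_rpow_mul_exp_mul_tsum {a b p : ℝ} (ha : 0 < a) (hb : 0 < b) (hp : 0 < p) (w : ℝ) :
    ∫ x in Ioi (0 : ℝ), x ^ (2 * a - 1) * Real.exp (-p * x ^ 2) *
        ∑' n : ℕ, (w * x) ^ (2 * n) / ((n.factorial : ℝ) * Real.Gamma (b + n)) =
      Real.Gamma a / (2 * Real.Gamma b * p ^ a) * hyp1F1 a b (w ^ 2 / p) := by
  have hΓa := Real.Gamma_pos_of_pos ha
  have hΓb := Real.Gamma_pos_of_pos hb
  have hΓ (n : ℕ) : 0 < Real.Gamma (b + n) := Real.Gamma_pos_of_pos (by positivity)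
  let c : ℕ → ℝ := fun n => w ^ (2 * n) / ((n.factorial : ℝ) * Real.Gamma (b + n))
  have hc (n : ℕ) : 0 ≤ c n := by
    have := hΓ n
    have : 0 ≤ w ^ (2 * n) := by rw [pow_mul]; positivity
    positivity
  let F : ℕ → ℝ → ℝ := fun n x => c n * (x ^ (2 * a - 1) * x ^ (2 * n) * Real.exp (-p * x ^ 2))
  have hF (n : ℕ) : ∫ x in Ioi (0 : ℝ), F n x =
      Real.Gamma a / (2 * Real.Gamma b * p ^ a) *
        (poch a n * (w ^ 2 / p) ^ n / (poch b n * (n.factorial : ℝ))) := by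
    have := hΓ n
    simp only [F, c]
    rw [integral_const_mul, integral_rpow_mul_pow_mul_exp_neg_mul_sq ha hp, poch, poch, div_pow,
      ← pow_mul]
    field_simp
  have hnorm (n : ℕ) : ∫ x in Ioi (0 : ℝ), ‖F n x‖ = ∫ x in Ioi (0 : ℝ), F n x := by
    refine setIntegral_congr_fun measurableSet_Ioi fun x (hx : 0 < x) => ?_
    have := hc n
    exact Real.norm_of_nonneg (by positivity)
  have hsum := hasSum_integral_of_summable_integral_norm (F := F)
    (μ := volume.restrict (Ioi (0 : ℝ)))
    (fun n => (integrableOn_rpow_mul_pow_mul_exp_neg_mul_sq ha hp n).const_mul (c n))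
    (by simp only [hnorm, hF]; exact (summable_hyp1F1 ha hb _).mul_left _)
  rw [hyp1F1, ← tsum_mul_left, ← tsum_congr hF, hsum.tsum_eq]
  congr 1 with x
  rw [← tsum_mul_left]
  refine tsum_congr fun n => ?_
  simp only [F, c, mul_pow]
  ring

/-- Eq. (2): PDF of the single shadowed κ-μ Type I model with Nakagami-m
shadowing of the dominant component (the κ-μ shadowed fading model). -/
theorem single_shadowed_typeI_nakagami_pdf
    (κ μ md rhat r σ d : ℝ)
    (hκ : 0 < κ) (hμ : 0 < μ) (hmd : 0 < md) (hrhat : 0 < rhat) (hr : 0 < r)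
    (hσ : σ = rhat / Real.sqrt (2 * μ * (1 + κ)))
    (hd : d = σ * Real.sqrt (2 * μ * κ)) :
    (∫ x in Ioi (0 : ℝ),
      (r ^ μ / (σ ^ 2 * (x * d) ^ (μ - 1))) *
        Real.exp (-(r ^ 2 + x ^ 2 * d ^ 2) / (2 * σ ^ 2)) *
        besselI (μ - 1) (x * d * r / σ ^ 2) *
        (2 * md ^ md * x ^ (2 * md - 1) * Real.exp (-md * x ^ 2) / Real.Gamma md)) =
    (2 * md ^ md * (1 + κ) ^ μ * μ ^ μ / (Real.Gamma μ * (md + κ * μ) ^ md)) *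
      (r ^ (2 * μ - 1) / rhat ^ (2 * μ)) *
      Real.exp (-(r ^ 2) * (1 + κ) * μ / rhat ^ 2) *
      hyp1F1 md μ (μ ^ 2 * κ * (1 + κ) * r ^ 2 / (rhat ^ 2 * (md + κ * μ))) := by
  have hκ' : 0 < 1 + κ := by positivity
  have hσ_pos : 0 < σ := by rw [hσ]; positivity
  have hd_pos : 0 < d := by rw [hd]; positivity
  have hσ_sq : σ ^ 2 = rhat ^ 2 / (2 * μ * (1 + κ)) := by
    rw [hσ, div_pow, Real.sq_sqrt (by positivity)]
  have hd_sq : d ^ 2 = σ ^ 2 * (2 * μ * κ) := by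
    rw [hd, mul_pow, Real.sq_sqrt (by positivity)]
  have hΓμ := Real.Gamma_pos_of_pos hμ
  have hΓmd := Real.Gamma_pos_of_pos hmd
  set w : ℝ := r * d / (2 * σ ^ 2) with hw
  set C : ℝ := r ^ μ / σ ^ 2 * (r / (2 * σ ^ 2)) ^ (μ - 1) * Real.exp (-r ^ 2 / (2 * σ ^ 2)) *
    (2 * md ^ md / Real.Gamma md) with hC
  have hint : ∀ x ∈ Ioi (0 : ℝ),
      (r ^ μ / (σ ^ 2 * (x * d) ^ (μ - 1))) *
        Real.exp (-(r ^ 2 + x ^ 2 * d ^ 2) / (2 * σ ^ 2)) *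
        besselI (μ - 1) (x * d * r / σ ^ 2) *
        (2 * md ^ md * x ^ (2 * md - 1) * Real.exp (-md * x ^ 2) / Real.Gamma md) =
      C * (x ^ (2 * md - 1) * Real.exp (-(md + κ * μ) * x ^ 2) *
        ∑' n : ℕ, (w * x) ^ (2 * n) / ((n.factorial : ℝ) * Real.Gamma (μ + n))) := by
    intro x hx
    have hx : 0 < x := hx
    have harg : x * d * r / σ ^ 2 = 2 * (w * x) := by rw [hw]; field_simp
    have hw_pos : 0 < w * x := by positivity
    have hpow : (w * x) ^ (μ - 1) = (r / (2 * σ ^ 2)) ^ (μ - 1) * (x * d) ^ (μ - 1) := by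
      rw [← Real.mul_rpow (by positivity) (by positivity), hw]
      congr 1
      ring
    have hexp₁ : Real.exp (-(r ^ 2 + x ^ 2 * d ^ 2) / (2 * σ ^ 2)) =
        Real.exp (-r ^ 2 / (2 * σ ^ 2)) * Real.exp (-(κ * μ) * x ^ 2) := by
      rw [← Real.exp_add, hd_sq]
      congr 1
      field_simp
      ring
    have hexp₂ : Real.exp (-(md + κ * μ) * x ^ 2) =
        Real.exp (-(κ * μ) * x ^ 2) * Real.exp (-md * x ^ 2) := by
      rw [← Real.exp_add]
      congr 1
      ring
    have hshift (n : ℕ) : μ - 1 + (n : ℝ) + 1 = μ + n := by ring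
    rw [harg, besselI_two_mul hw_pos, hpow, hexp₁, hexp₂, hC]
    simp only [hshift]
    have : 0 < (x * d) ^ (μ - 1) := by positivity
    field_simp
  rw [setIntegral_congr_fun measurableSet_Ioi hint, integral_const_mul,
    integral_rpow_mul_exp_mul_tsum hmd hμ (by positivity)]
  have hz : w ^ 2 / (md + κ * μ) =
      μ ^ 2 * κ * (1 + κ) * r ^ 2 / (rhat ^ 2 * (md + κ * μ)) := by
    rw [hw, div_pow, mul_pow, hd_sq, mul_pow, hσ_sq]
    field_simp
  have hexp : -r ^ 2 / (2 * σ ^ 2) = -(r ^ 2) * (1 + κ) * μ / rhat ^ 2 := by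
    rw [hσ_sq]
    field_simp
  have hpow : r ^ μ / σ ^ 2 * (r / (2 * σ ^ 2)) ^ (μ - 1) =
      2 * ((1 + κ) ^ μ * μ ^ μ) * (r ^ (2 * μ - 1) / rhat ^ (2 * μ)) := by
    have hr_pow : r ^ (2 * μ - 1) = r ^ μ * r ^ μ / r := by
      rw [Real.rpow_sub_one hr.ne', two_mul, Real.rpow_add hr]
    have hrhat_pow : rhat ^ (2 * μ) = (rhat ^ 2) ^ μ := by
      rw [Real.rpow_mul hrhat.le, Real.rpow_two]
    have hbase : r / (2 * σ ^ 2) = r * ((1 + κ) * μ) / rhat ^ 2 := by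
      rw [hσ_sq]
      field_simp
    rw [Real.rpow_sub_one (by positivity), hbase, hr_pow, hrhat_pow,
      Real.div_rpow (by positivity) (by positivity), Real.mul_rpow hr.le (by positivity),
      Real.mul_rpow hκ'.le hμ.le, hσ_sq]
    field_simp
  rw [hz, hC, hpow, hexp]
  field_simp
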